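/- A finite-dimensional power-commutative real division algebra is quadratic if and only if it contains an identity element. -/

import Mathlib

open Module

section Defs

variable {A : Type*} [AddCommGroup A] [Module ℝ A]

/-- A linear subspace closed under the multiplication `m`. -/
def IsSubalg (m : A →ₗ[ℝ] A →ₗ[ℝ] A) (U : Submodule ℝ A) : Prop :=
  ∀ x ∈ U, ∀ y ∈ U, m x y ∈ U

/-- The subalgebra generated by a set `s`: the smallest subspace containing `s`
and closed under multiplication. -/
def genSubalg (m : A →ₗ[ℝ] A →ₗ[ℝ] A) (s : Set A) : Submodule ℝ A :=
  sInf {U : Submodule ℝ A | IsSubalg m U ∧ s ⊆ (U : Set A)}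

/-- `m` is a division-algebra multiplication: for nonzero `a`, both left and
right multiplication by `a` are bijective. -/
def IsDivision (m : A →ₗ[ℝ] A →ₗ[ℝ] A) : Prop :=
  ∀ a : A, a ≠ 0 →
    Function.Bijective (fun x : A => m a x) ∧ Function.Bijective (fun x : A => m x a)

/-- Power-commutativity: every subalgebra generated by a single element is commutative. -/
def PowerComm (m : A →ₗ[ℝ] A →ₗ[ℝ] A) : Prop :=
  ∀ x : A, ∀ a ∈ genSubalg m {x}, ∀ b ∈ genSubalg m {x}, m a b = m b a

/-- An omnipresent idempotent: a nonzero idempotent contained in every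
two-dimensional subalgebra. -/
def Omnipresent (m : A →ₗ[ℝ] A →ₗ[ℝ] A) (e : A) : Prop :=
  e ≠ 0 ∧ m e e = e ∧
    ∀ U : Submodule ℝ A, IsSubalg m U → Module.finrank ℝ U = 2 → e ∈ U

/-- `one` is an identity element for `m` and for every `x` the elements
`one, x, x²` are linearly dependent. -/
def IsQuadraticWith (m : A →ₗ[ℝ] A →ₗ[ℝ] A) (one : A) : Prop :=
  (∀ x : A, m one x = x ∧ m x one = x) ∧
    ∀ x : A, ¬ LinearIndependent ℝ ![one, x, m x x]

/-- A quadratic algebra: unital, and `1, x, x²` linearly dependent for all `x`. -/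
def IsQuadratic (m : A →ₗ[ℝ] A →ₗ[ℝ] A) : Prop :=
  ∃ one : A, IsQuadraticWith m one

/-- The isotope multiplication `x ∘ y = (T x)·(T y)`. -/
def isotope (m : A →ₗ[ℝ] A →ₗ[ℝ] A) (T : A →ₗ[ℝ] A) : A →ₗ[ℝ] A →ₗ[ℝ] A :=
  (m.compl₂ T).comp T

/-- A planar map on a quadratic division algebra with identity `one`:
invertible, fixes `one`, and leaves every subalgebra invariant. -/
def Planar (m : A →ₗ[ℝ] A →ₗ[ℝ] A) (one : A) (T : A →ₗ[ℝ] A) : Prop :=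
  Function.Bijective T ∧ T one = one ∧
    ∀ U : Submodule ℝ A, IsSubalg m U → ∀ x ∈ U, T x ∈ U

/-- The imaginary space `Im B = {x ∉ ℝ·1 : x² ∈ ℝ·1} ∪ {0}` of a quadratic algebra. -/
def ImSet (m : A →ₗ[ℝ] A →ₗ[ℝ] A) (one : A) : Set A :=
  {x : A | x ∉ Submodule.span ℝ {one} ∧ m x x ∈ Submodule.span ℝ {one}} ∪ {0}

/-- The centraliser `C(e) = {y : e·y = y·e}`, a linear subspace. -/
def centraliser (m : A →ₗ[ℝ] A →ₗ[ℝ] A) (e : A) : Submodule ℝ A :=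
  LinearMap.ker (m e - m.flip e)

/-- An exceptional idempotent of a four-dimensional algebra: its centraliser is
three-dimensional and closed under squaring. -/
def Exceptional (m : A →ₗ[ℝ] A →ₗ[ℝ] A) (e : A) : Prop :=
  Module.finrank ℝ (centraliser m e) = 3 ∧
    ∀ x ∈ centraliser m e, m x x ∈ centraliser m e

end Defs

section Hopf

variable {E : Type*} [NormedAddCommGroup E] [NormedSpace ℝ E] [FiniteDimensional ℝ E]
  {m : E →ₗ[ℝ] E →ₗ[ℝ] E}

lemma continuous_mul_self (m : E →ₗ[ℝ] E →ₗ[ℝ] E) : Continuous fun x => m x x :=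
  (m.toContinuousBilinearMap.continuous.clm_apply continuous_id :)

lemma eq_or_eq_neg_of_mul_self_eq {V : Type*} [AddCommGroup V] [Module ℝ V]
    {m : V →ₗ[ℝ] V →ₗ[ℝ] V} (hcomm : ∀ x y, m x y = m y x)
    (hzero : ∀ x y, m x y = 0 → x = 0 ∨ y = 0) {x y : V} (h : m x x = m y y) :
    x = y ∨ x = -y := by
  have hprod : m (x - y) (x + y) = 0 := by
    simp only [map_sub, map_add, LinearMap.sub_apply, h, hcomm y x]
    abel
  rcases hzero _ _ hprod with h | h
  · exact Or.inl (sub_eq_zero.mp h)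
  · exact Or.inr (eq_neg_of_add_eq_zero_left h)

/-- Squaring in a finite-dimensional algebra without nonzero square-zero elements is proper. -/
lemma isProperMap_mul_self [Nontrivial E] (hsq : ∀ x, m x x = 0 → x = 0) :
    IsProperMap fun x => m x x := by
  have hcont := continuous_mul_self m
  rw [isProperMap_iff_tendsto_cocompact]
  refine ⟨hcont, ?_⟩
  obtain ⟨x₀, hx₀, hmin⟩ := (isCompact_sphere (0 : E) 1).exists_isMinOn
    (NormedSpace.sphere_nonempty.mpr zero_le_one) hcont.norm.continuousOn
  have hpos : 0 < ‖m x₀ x₀‖ := by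
    rw [norm_pos_iff]
    intro h
    simp [hsq _ h] at hx₀
  have hbound (x : E) : ‖m x₀ x₀‖ * ‖x‖ ^ 2 ≤ ‖m x x‖ := by
    rcases eq_or_ne x 0 with rfl | hx
    · simp
    have hx' : ‖x‖ ≠ 0 := norm_ne_zero_iff.mpr hx
    have hunit : ‖x‖⁻¹ • x ∈ Metric.sphere (0 : E) 1 := by
      simp [norm_smul, hx']
    have hle := hmin hunit
    simp only [Set.mem_ofPred_eq, map_smul, LinearMap.smul_apply, norm_smul, norm_inv,
      norm_norm] at hle
    calc ‖m x₀ x₀‖ * ‖x‖ ^ 2 ≤ (‖x‖⁻¹ * (‖x‖⁻¹ * ‖m x x‖)) * ‖x‖ ^ 2 := by gcongr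
      _ = ‖m x x‖ := by field_simp
  rw [← Metric.cobounded_eq_cocompact, ← tendsto_norm_atTop_iff_cobounded,
    Metric.cobounded_eq_cocompact]
  refine Filter.tendsto_atTop_mono hbound ?_
  exact ((Filter.tendsto_pow_atTop two_ne_zero).comp
    (tendsto_norm_cocompact_atTop (E := E))).const_mul_atTop hpos

lemma isLocalHomeomorphOn_mul_self (hcomm : ∀ x y, m x y = m y x)
    (hzero : ∀ x y, m x y = 0 → x = 0 ∨ y = 0) :
    IsLocalHomeomorphOn (fun x => m x x) {0}ᶜ := by
  refine IsLocalHomeomorphOn.mk _ _ fun x hx => ?_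
  have hinj : Function.Injective ((2 : ℝ) • m x) := by
    rw [injective_iff_map_eq_zero]
    intro y hy
    have hxy : m x y = 0 := by simpa using hy
    exact (hzero x y hxy).resolve_left hx
  let e : E ≃L[ℝ] E := (LinearEquiv.ofInjectiveEndo _ hinj).toContinuousLinearEquiv
  have hderiv : HasStrictFDerivAt (fun x => m x x) (e : E →L[ℝ] E) x := by
    have h := m.toContinuousBilinearMap.hasStrictFDerivAt_of_bilinear
      (hasStrictFDerivAt_id x) (hasStrictFDerivAt_id x)
    convert! h using 1
    ext y
    change (2 : ℝ) • m x y = m x y + m y x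
    rw [hcomm y x, two_smul]
  exact ⟨hderiv.toOpenPartialHomeomorph _, hderiv.mem_toOpenPartialHomeomorph_source,
    fun _ _ => rfl⟩

lemma isCoveringMapOn_mul_self [Nontrivial E] (hcomm : ∀ x y, m x y = m y x)
    (hzero : ∀ x y, m x y = 0 → x = 0 ∨ y = 0) :
    IsCoveringMapOn (fun x => m x x) {0}ᶜ := by
  have hsq (x : E) (h : m x x = 0) : x = 0 := by simpa using hzero x x h
  refine (isProperMap_mul_self hsq).isClosedMap.isCoveringMapOn_of_isLocalHomeomorphOn
    (fun y _ => ?_) ((isLocalHomeomorphOn_mul_self hcomm hzero).mono fun x hx h => ?_)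
  · rcases Set.eq_empty_or_nonempty ((fun x => m x x) ⁻¹' {y}) with h | ⟨x, hx⟩
    · rw [h]
      exact Set.finite_empty
    · refine (Set.toFinite {x, -x}).subset fun z hz => ?_
      exact eq_or_eq_neg_of_mul_self_eq hcomm hzero (hz.trans hx.symm)
  · exact hx (by simp [Set.mem_singleton_iff.mp h])

lemma surjective_mul_self (hcomm : ∀ x y, m x y = m y x)
    (hzero : ∀ x y, m x y = 0 → x = 0 ∨ y = 0) (hdim : 1 < finrank ℝ E) :
    Function.Surjective fun x => m x x := by
  have : Nontrivial E := Module.nontrivial_of_finrank_pos (R := ℝ) (by omega)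
  have hsq (x : E) (h : m x x = 0) : x = 0 := by simpa using hzero x x h
  have hopen : IsOpen ((fun x => m x x) '' {0}ᶜ) := by
    rw [isOpen_iff_mem_nhds]
    rintro _ ⟨x, hx, rfl⟩
    rw [← (isLocalHomeomorphOn_mul_self hcomm hzero).map_nhds_eq hx]
    exact Filter.image_mem_map (isOpen_compl_singleton.mem_nhds hx)
  have hclosed : IsClosed (Set.range fun x => m x x) :=
    (isProperMap_mul_self hsq).isClosedMap.isClosed_range
  have hconn : IsPreconnected ({0}ᶜ : Set E) :=
    (isConnected_compl_singleton_of_one_lt_rank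
      (by rw [← finrank_eq_rank]; exact_mod_cast hdim) 0).isPreconnected
  obtain ⟨x, hx⟩ := exists_ne (0 : E)
  have hsub : ({0}ᶜ : Set E) ⊆ (fun x => m x x) '' {0}ᶜ := by
    refine hconn.subset_left_of_subset_union hopen hclosed.isOpen_compl ?_ ?_
      ⟨m x x, fun h => hx (hsq x h), x, hx, rfl⟩
    · exact Set.disjoint_left.mpr fun y ⟨z, _, hz⟩ hy => hy ⟨z, hz⟩
    · intro y hy
      by_cases hr : y ∈ Set.range fun x => m x x
      · obtain ⟨z, rfl⟩ := hr
        exact Or.inl ⟨z, fun hz => hy (by simp [Set.mem_singleton_iff.mp hz]), rfl⟩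
      · exact Or.inr hr
  intro y
  rcases eq_or_ne y 0 with rfl | hy
  · exact ⟨0, by simp⟩
  · obtain ⟨z, _, hz⟩ := hsub hy
    exact ⟨z, hz⟩

/-- **Hopf's theorem**, normed version: the squaring map is a double covering of the complement of
the origin, which is impossible in dimension at least three. -/
lemma finrank_le_two_of_comm_normed (hcomm : ∀ x y, m x y = m y x)
    (hzero : ∀ x y, m x y = 0 → x = 0 ∨ y = 0) : finrank ℝ E ≤ 2 := by
  by_contra! hdim
  have : Nontrivial E := Module.nontrivial_of_finrank_pos (R := ℝ) (by omega)
  obtain ⟨u, hu⟩ := exists_ne (0 : E)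
  obtain ⟨v, hv : m v v = -m u u⟩ := surjective_mul_self hcomm hzero (by omega) (-m u u)
  obtain ⟨j, hj⟩ : ∃ j, j ∉ Submodule.span ℝ {m u u, m u v} := by
    by_contra! hall
    have htop : Submodule.span ℝ {m u u, m u v} = ⊤ := Submodule.eq_top_iff'.mpr hall
    have hcard := finrank_range_le_card (R := ℝ) ![m u u, m u v]
    rw [Set.finrank, Matrix.range_cons_cons_empty, htop, finrank_top, Fintype.card_fin] at hcard
    omega
  have hsq (x : E) (h : m x x = 0) : x = 0 := by simpa using hzero x x h
  let γ : C(ℝ, E) := ⟨fun t => Real.cos t • u + Real.sin t • v, by fun_prop⟩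
  let h : C(ℂ, E) := ⟨fun z => z.re • m u u + z.im • m u v + (1 - ‖z‖) • j, by fun_prop⟩
  let c : C(ℝ, ℂ) := ⟨fun t => Complex.exp ((2 * t : ℝ) * Complex.I), by fun_prop⟩
  have hγ (t : ℝ) : m (γ t) (γ t) = h (c t) := by
    simp only [γ, h, c, ContinuousMap.coe_mk, Complex.exp_ofReal_mul_I_re,
      Complex.exp_ofReal_mul_I_im, Complex.norm_exp_ofReal_mul_I, map_add, map_smul,
      LinearMap.add_apply, LinearMap.smul_apply, hcomm v u, hv, Real.cos_two_mul', Real.sin_two_mul]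
    module
  have hγ0 (t : ℝ) : γ t ≠ 0 := by
    intro ht
    have hcs : Real.cos t • u = -(Real.sin t • v) := eq_neg_of_add_eq_zero_left ht
    have hmul : m (Real.cos t • u) (Real.cos t • u) = m (Real.sin t • v) (Real.sin t • v) := by
      simp [hcs]
    simp only [map_smul, LinearMap.smul_apply, hv] at hmul
    refine hu (hsq u ?_)
    calc m u u = (Real.cos t ^ 2 + Real.sin t ^ 2) • m u u := by
          rw [Real.cos_sq_add_sin_sq, one_smul]
      _ = Real.cos t • Real.cos t • m u u - Real.sin t • Real.sin t • -m u u := by module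
      _ = 0 := sub_eq_zero.mpr hmul
  have hcirc (z : ℂ) (hz : ‖z‖ = 1) : ∃ t, c t = z := by
    refine ⟨z.arg / 2, ?_⟩
    have := Complex.norm_mul_exp_arg_mul_I z
    simp only [c, ContinuousMap.coe_mk]
    rw [mul_div_cancel₀ _ two_ne_zero]
    simpa [hz] using this
  have hh (z : ℂ) : h z ∈ ({0}ᶜ : Set E) := by
    intro h0
    by_cases hz : ‖z‖ = 1
    · obtain ⟨t, rfl⟩ := hcirc z hz
      exact hγ0 t (hsq _ ((hγ t).trans h0))
    · refine hj ?_
      have hz' : 1 - ‖z‖ ≠ 0 := sub_ne_zero.mpr (Ne.symm hz)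
      rw [← Submodule.smul_mem_iff _ hz']
      refine Submodule.mem_span_pair.mpr ⟨-z.re, -z.im, ?_⟩
      have : z.re • m u u + z.im • m u v + (1 - ‖z‖) • j = 0 := h0
      rw [← eq_neg_iff_add_eq_zero] at this
      rw [neg_smul, neg_smul, ← neg_add, this, neg_neg]
  have hcov := isCoveringMapOn_mul_self hcomm hzero
  obtain ⟨F, ⟨hF1, hF⟩, -⟩ := hcov.existsUnique_continuousMap_lifts h (a₀ := 1) (e₀ := u)
    (by simp [h]) hh
  have hc0 : c 0 = 1 := by simp [c]
  have hcpi : c Real.pi = 1 := by simp [c, Complex.exp_two_pi_mul_I]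
  have hFγ : F.comp c = γ :=
    (hcov.existsUnique_continuousMap_lifts (h.comp c) (a₀ := 0) (e₀ := u)
      (by simp [h, hc0]) fun t => hh (c t)).unique
      ⟨by simp [hc0, hF1], funext fun t => congrFun hF (c t)⟩ ⟨by simp [γ], funext hγ⟩
  have hpi := DFunLike.congr_fun hFγ Real.pi
  have hneg : u = -u := by simpa [hcpi, hF1, γ] using hpi
  have htwo : (2 : ℝ) • u = 0 := by
    rw [two_smul, ← eq_neg_iff_add_eq_zero]
    exact hneg
  exact hu ((smul_eq_zero_iff_right two_ne_zero).mp htwo)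

end Hopf

/-- **Hopf's theorem**: a finite-dimensional commutative real algebra without zero divisors has
dimension at most two. -/
theorem finrank_le_two_of_comm {V : Type*} [AddCommGroup V] [Module ℝ V] [FiniteDimensional ℝ V]
    {m : V →ₗ[ℝ] V →ₗ[ℝ] V} (hcomm : ∀ x y, m x y = m y x)
    (hzero : ∀ x y, m x y = 0 → x = 0 ∨ y = 0) : finrank ℝ V ≤ 2 := by
  let e : V ≃ₗ[ℝ] (Fin (finrank ℝ V) → ℝ) := (finBasis ℝ V).equivFun
  let m' := (m.compl₁₂ e.symm.toLinearMap e.symm.toLinearMap).compr₂ e.toLinearMap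
  have happ (x y) : m' x y = e (m (e.symm x) (e.symm y)) := rfl
  rw [e.finrank_eq]
  refine finrank_le_two_of_comm_normed (m := m') (fun x y => ?_) fun x y h => ?_
  · rw [happ, happ, hcomm]
  · simpa using hzero _ _ (e.map_eq_zero_iff.mp ((happ x y).symm.trans h))

section Generated

variable {A : Type*} [AddCommGroup A] [Module ℝ A] {m : A →ₗ[ℝ] A →ₗ[ℝ] A}

lemma isSubalg_genSubalg (m : A →ₗ[ℝ] A →ₗ[ℝ] A) (s : Set A) : IsSubalg m (genSubalg m s) := by
  intro x hx y hy
  simp only [genSubalg, Submodule.mem_sInf] at hx hy ⊢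
  exact fun U hU => hU.1 x (hx U hU) y (hy U hU)

lemma subset_genSubalg (m : A →ₗ[ℝ] A →ₗ[ℝ] A) (s : Set A) : s ⊆ genSubalg m s := by
  intro x hx
  simp only [genSubalg, SetLike.mem_coe, Submodule.mem_sInf]
  exact fun U hU => hU.2 hx

lemma IsDivision.eq_zero_or_eq_zero (hdiv : IsDivision m) {x y : A} (h : m x y = 0) :
    x = 0 ∨ y = 0 := by
  by_contra! hne
  exact hne.2 ((hdiv x hne.1).1.1 (h.trans (map_zero (m x)).symm))

/-- In a finite-dimensional division algebra, every nonzero subalgebra contains the identity. -/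
lemma IsSubalg.one_mem [FiniteDimensional ℝ A] (hdiv : IsDivision m) {U : Submodule ℝ A}
    (hU : IsSubalg m U) {one x : A} (hone : m x one = x) (hx : x ∈ U) (hx0 : x ≠ 0) :
    one ∈ U := by
  have hinj : Function.Injective ((m x).restrict (hU x hx)) := fun a b hab =>
    Subtype.ext ((hdiv x hx0).1.1 (congrArg Subtype.val hab))
  obtain ⟨e, he⟩ := LinearMap.surjective_of_injective hinj ⟨x, hx⟩
  have hxe : m x e = m x one := (congrArg Subtype.val he).trans hone.symm
  rw [← (hdiv x hx0).1.1 hxe]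
  exact e.2

lemma IsSubalg.finrank_le_two [FiniteDimensional ℝ A] (hdiv : IsDivision m) {U : Submodule ℝ A}
    (hU : IsSubalg m U) (hcomm : ∀ a ∈ U, ∀ b ∈ U, m a b = m b a) : finrank ℝ U ≤ 2 := by
  let mU : U →ₗ[ℝ] U →ₗ[ℝ] U := LinearMap.mk₂ ℝ (fun a b => ⟨m a b, hU a a.2 b b.2⟩)
    (fun _ _ _ => by ext; simp) (fun _ _ _ => by ext; simp)
    (fun _ _ _ => by ext; simp) (fun _ _ _ => by ext; simp)
  refine finrank_le_two_of_comm (m := mU) (fun a b => Subtype.ext (hcomm a a.2 b b.2))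
    fun a b hab => ?_
  simpa using hdiv.eq_zero_or_eq_zero (congrArg Subtype.val hab)

end Generated

/-- A finite-dimensional power-commutative real division algebra is
quadratic iff it contains an identity element. -/
theorem stmt_6 {A : Type*} [AddCommGroup A] [Module ℝ A] [FiniteDimensional ℝ A]
    (m : A →ₗ[ℝ] A →ₗ[ℝ] A) (hdiv : IsDivision m) (hpc : PowerComm m) :
    IsQuadratic m ↔ ∃ one : A, ∀ x : A, m one x = x ∧ m x one = x := by
  refine ⟨fun ⟨one, h, _⟩ => ⟨one, h⟩, fun ⟨one, hone⟩ => ⟨one, hone, fun x hli => ?_⟩⟩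
  have hx0 : x ≠ 0 := hli.ne_zero 1
  have hU := isSubalg_genSubalg m {x}
  have hx : x ∈ genSubalg m {x} := subset_genSubalg m {x} rfl
  have hle := hU.finrank_le_two hdiv (hpc x)
  have hspan : Submodule.span ℝ (Set.range ![one, x, m x x]) ≤ genSubalg m {x} := by
    rw [Submodule.span_le, Set.range_subset_iff]
    intro i
    fin_cases i
    · exact hU.one_mem hdiv (hone x).2 hx hx0
    · exact hx
    · exact hU x hx x hx
  have hcard := (finrank_span_eq_card hli).symm.le.trans (Submodule.finrank_mono hspan)
  rw [Fintype.card_fin] at hcard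
  omega
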